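/- Let L ≥ T > 2, let h be a standard Gaussian vector in ℝ^L, and let C = sqrt(∑_{i=1}^L h_i²)/sqrt(∑_{i=1}^T h_i²). Then for any k > 0, with probability at least 1 − 1/k², C ≤ sqrt((L-2)/(T-2)) + k·sqrt((L-2)/(T-2) − L/T). -/

import Mathlib

open MeasureTheory ProbabilityTheory
open scoped ENNReal

lemma integral_exp_neg_mul_sq_gaussianReal {s : ℝ} (hs : 0 ≤ s) :
    ∫ x, Real.exp (-s * x ^ 2) ∂gaussianReal 0 1 = (1 + 2 * s) ^ (-(1 / 2) : ℝ) := by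
  have h : ∀ x : ℝ, gaussianPDFReal 0 1 x • Real.exp (-s * x ^ 2) =
      (√(2 * Real.pi))⁻¹ * Real.exp (-(s + 1 / 2) * x ^ 2) := by
    intro x
    rw [gaussianPDFReal, smul_eq_mul, mul_assoc, ← Real.exp_add]
    simp only [NNReal.coe_one, mul_one, sub_zero]
    ring_nf
  rw [integral_gaussianReal_eq_integral_smul one_ne_zero]
  simp_rw [h]
  rw [integral_const_mul, integral_gaussian, Real.rpow_neg (by linarith), ← Real.sqrt_eq_rpow,
    ← Real.sqrt_inv, ← Real.sqrt_inv, ← Real.sqrt_mul (by positivity)]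
  congr 1
  have : 0 < Real.pi := Real.pi_pos
  have : 0 < 1 + 2 * s := by linarith
  have : 0 < s + 1 / 2 := by linarith
  field_simp
  ring

lemma integrable_exp_neg_mul_sq_gaussianReal {s : ℝ} (hs : 0 ≤ s) :
    Integrable (fun x ↦ Real.exp (-s * x ^ 2)) (gaussianReal 0 1) := by
  refine Integrable.of_bound (by fun_prop) 1 (ae_of_all _ fun x ↦ ?_)
  rw [Real.norm_eq_abs, Real.abs_exp, Real.exp_le_one_iff]
  nlinarith [mul_nonneg hs (sq_nonneg x)]

lemma integral_sq_gaussianReal : ∫ x, x ^ 2 ∂gaussianReal 0 1 = 1 := by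
  have h := variance_eq_sub (memLp_id_gaussianReal (μ := 0) (v := 1) 2)
  rw [variance_id_gaussianReal] at h
  simpa using h.symm

lemma integrable_sq_gaussianReal : Integrable (fun x ↦ x ^ 2) (gaussianReal 0 1) :=
  (memLp_id_gaussianReal (μ := 0) (v := 1) 2).integrable_sq

lemma lintegral_rpow_neg_half {p : ℝ} (hp : 2 < p) :
    ∫⁻ s in Set.Ioi (0 : ℝ), ENNReal.ofReal ((1 + 2 * s) ^ (-(p / 2))) =
      ENNReal.ofReal (1 / (p - 2)) := by
  have hp' : p - 2 ≠ 0 := by linarith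
  have hd : ∀ s ∈ Set.Ici (0 : ℝ), HasDerivAt
      (fun s : ℝ ↦ -(1 / (p - 2)) * (1 + 2 * s) ^ (1 - p / 2)) ((1 + 2 * s) ^ (-(p / 2))) s := by
    intro s hs
    have hs : 0 ≤ s := hs
    have h1 : HasDerivAt (fun s : ℝ ↦ 1 + 2 * s) 2 s := by
      simpa using ((hasDerivAt_id s).const_mul 2).const_add 1
    refine ((h1.rpow_const (p := 1 - p / 2) (Or.inl (by linarith))).const_mul _).congr_deriv ?_
    rw [show 1 - p / 2 - 1 = -(p / 2) by ring]
    field_simp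
    ring
  have hn : ∀ s ∈ Set.Ioi (0 : ℝ), 0 ≤ (1 + 2 * s) ^ (-(p / 2)) := by
    intro s hs
    have hs : 0 < s := hs
    positivity
  have ht : Filter.Tendsto (fun s : ℝ ↦ -(1 / (p - 2)) * (1 + 2 * s) ^ (1 - p / 2))
      Filter.atTop (nhds 0) := by
    have h1 : Filter.Tendsto (fun s : ℝ ↦ 1 + 2 * s) Filter.atTop Filter.atTop :=
      Filter.tendsto_atTop_add_const_left _ _ (Filter.tendsto_id.const_mul_atTop two_pos)
    have h2 := ((tendsto_rpow_neg_atTop (y := p / 2 - 1) (by linarith)).comp h1).const_mul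
      (-(1 / (p - 2)))
    simpa [Function.comp_def] using h2
  rw [← ofReal_integral_eq_lintegral_ofReal (integrableOn_Ioi_deriv_of_nonneg' hd hn ht)
    ((ae_restrict_iff' measurableSet_Ioi).2 (ae_of_all _ hn)),
    integral_Ioi_of_hasDerivAt_of_nonneg' hd hn ht]
  simp

lemma ofReal_div_le_lintegral_exp {a b : ℝ} (ha : 0 ≤ a) :
    ENNReal.ofReal (b / a) ≤
      ∫⁻ s in Set.Ioi (0 : ℝ), ENNReal.ofReal (b * Real.exp (-s * a)) := by
  rcases ha.eq_or_lt with rfl | ha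
  · simp
  rcases le_or_gt b 0 with hb | hb
  · rw [ENNReal.ofReal_of_nonpos (div_nonpos_of_nonpos_of_nonneg hb ha.le)]
    exact zero_le
  · have hi := integrableOn_exp_mul_Ioi (a := -a) (by linarith) 0
    have he : ∀ s : ℝ, b * Real.exp (-s * a) = b * Real.exp (-a * s) := fun s ↦ by ring_nf
    simp_rw [he]
    rw [← ofReal_integral_eq_lintegral_ofReal (hi.const_mul b)
      (ae_of_all _ fun s ↦ by positivity), integral_const_mul, integral_exp_mul_Ioi (by linarith)]
    simp [div_eq_mul_inv]

section StandardGaussian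

variable {ι : Type*} [Fintype ι]

lemma lintegral_sq_mul_exp_pi_gaussianReal {J : Finset ι} {j : ι} (hj : j ∉ J) {s : ℝ}
    (hs : 0 ≤ s) :
    ∫⁻ h, ENNReal.ofReal (h j ^ 2 * Real.exp (-s * ∑ i ∈ J, h i ^ 2))
        ∂(Measure.pi fun _ : ι ↦ gaussianReal 0 1) =
      ENNReal.ofReal ((1 + 2 * s) ^ (-((J.card : ℝ) / 2))) := by
  classical
  let f : ι → ℝ → ℝ := fun i x ↦
    (if i = j then x ^ 2 else 1) * if i ∈ J then Real.exp (-s * x ^ 2) else 1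
  have hf : ∀ h : ι → ℝ, h j ^ 2 * Real.exp (-s * ∑ i ∈ J, h i ^ 2) = ∏ i, f i (h i) := by
    intro h
    simp only [f, Finset.prod_mul_distrib, Finset.mul_sum, Real.exp_sum]
    simp
  have hcase : ∀ i, Integrable (f i) (gaussianReal 0 1) ∧
      ∫ x, f i x ∂gaussianReal 0 1 = if i ∈ J then (1 + 2 * s) ^ (-(1 / 2) : ℝ) else 1 := by
    intro i
    by_cases hij : i = j
    · subst hij
      simp [f, hj, integrable_sq_gaussianReal, integral_sq_gaussianReal]
    · by_cases hi : i ∈ J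
      · simpa only [f, hij, hi, if_true, if_false, one_mul] using
          And.intro (integrable_exp_neg_mul_sq_gaussianReal hs)
            (integral_exp_neg_mul_sq_gaussianReal hs)
      · simp [f, hij, hi]
  simp_rw [hf]
  rw [← ofReal_integral_eq_lintegral_ofReal (Integrable.fintype_prod fun i ↦ (hcase i).1)
    (ae_of_all _ fun h ↦ (hf h).le.trans' (by positivity)),
    integral_fintype_prod_eq_prod]
  simp_rw [fun i ↦ (hcase i).2]
  rw [Finset.prod_ite_mem, Finset.univ_inter, Finset.prod_const,
    ← Real.rpow_mul_natCast (by linarith)]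
  congr 2
  ring

lemma lintegral_sq_div_sum_sq_le {J : Finset ι} {j : ι} (hj : j ∉ J) (hJ : 2 < J.card) :
    ∫⁻ h, ENNReal.ofReal (h j ^ 2 / ∑ i ∈ J, h i ^ 2)
        ∂(Measure.pi fun _ : ι ↦ gaussianReal 0 1) ≤
      ENNReal.ofReal (1 / ((J.card : ℝ) - 2)) := by
  calc
    _ ≤ ∫⁻ h, ∫⁻ s in Set.Ioi (0 : ℝ),
          ENNReal.ofReal (h j ^ 2 * Real.exp (-s * ∑ i ∈ J, h i ^ 2))
          ∂volume ∂(Measure.pi fun _ : ι ↦ gaussianReal 0 1) :=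
      lintegral_mono fun h ↦ ofReal_div_le_lintegral_exp
        (Finset.sum_nonneg fun i _ ↦ sq_nonneg (h i))
    _ = ∫⁻ s in Set.Ioi (0 : ℝ), ∫⁻ h,
          ENNReal.ofReal (h j ^ 2 * Real.exp (-s * ∑ i ∈ J, h i ^ 2))
          ∂(Measure.pi fun _ : ι ↦ gaussianReal 0 1) :=
      lintegral_lintegral_swap (by unfold Function.uncurry; fun_prop)
    _ = ∫⁻ s in Set.Ioi (0 : ℝ), ENNReal.ofReal ((1 + 2 * s) ^ (-((J.card : ℝ) / 2))) :=
      setLIntegral_congr_fun measurableSet_Ioi fun s hs ↦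
        lintegral_sq_mul_exp_pi_gaussianReal hj (le_of_lt hs)
    _ = _ := lintegral_rpow_neg_half (by exact_mod_cast hJ)

lemma integrable_sq_div_sum_sq {J : Finset ι} {j : ι} (hj : j ∉ J) (hJ : 2 < J.card) :
    Integrable (fun h : ι → ℝ ↦ h j ^ 2 / ∑ i ∈ J, h i ^ 2)
      (Measure.pi fun _ : ι ↦ gaussianReal 0 1) := by
  refine (lintegral_ofReal_ne_top_iff_integrable
    (Measurable.aestronglyMeasurable (by fun_prop)) (ae_of_all _ fun h ↦ ?_)).1 ?_
  · exact div_nonneg (sq_nonneg _) (Finset.sum_nonneg fun i _ ↦ sq_nonneg _)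
  · exact ((lintegral_sq_div_sum_sq_le hj hJ).trans_lt ENNReal.ofReal_lt_top).ne

lemma integral_sq_div_sum_sq_le {J : Finset ι} {j : ι} (hj : j ∉ J) (hJ : 2 < J.card) :
    ∫ h, h j ^ 2 / ∑ i ∈ J, h i ^ 2 ∂(Measure.pi fun _ : ι ↦ gaussianReal 0 1) ≤
      1 / ((J.card : ℝ) - 2) := by
  have hJ' : (2 : ℝ) < J.card := by exact_mod_cast hJ
  rw [integral_eq_lintegral_of_nonneg_ae (ae_of_all _ fun h ↦
    div_nonneg (sq_nonneg _) (Finset.sum_nonneg fun i _ ↦ sq_nonneg _))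
    (integrable_sq_div_sum_sq hj hJ).aestronglyMeasurable]
  exact ENNReal.toReal_le_of_le_ofReal (one_div_nonneg.2 (by linarith))
    (lintegral_sq_div_sum_sq_le hj hJ)

lemma sum_sq_div_sum_sq_mem_Icc (J : Finset ι) (h : ι → ℝ) :
    (∑ i ∈ J, h i ^ 2) / ∑ i, h i ^ 2 ∈ Set.Icc (0 : ℝ) 1 :=
  ⟨div_nonneg (Finset.sum_nonneg fun _ _ ↦ sq_nonneg _) (Finset.sum_nonneg fun _ _ ↦ sq_nonneg _),
    div_le_one_of_le₀ (Finset.sum_le_sum_of_subset_of_nonneg (Finset.subset_univ J)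
      fun _ _ _ ↦ sq_nonneg _) (Finset.sum_nonneg fun _ _ ↦ sq_nonneg _)⟩

lemma integrable_sum_sq_div_sum_sq (J : Finset ι) :
    Integrable (fun h : ι → ℝ ↦ (∑ i ∈ J, h i ^ 2) / ∑ i, h i ^ 2)
      (Measure.pi fun _ : ι ↦ gaussianReal 0 1) := by
  refine Integrable.of_bound (Measurable.aestronglyMeasurable (by fun_prop)) 1
    (ae_of_all _ fun h ↦ ?_)
  have := sum_sq_div_sum_sq_mem_Icc J h
  rw [Real.norm_eq_abs, abs_of_nonneg this.1]
  exact this.2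

lemma integral_sum_sq_div_sum_sq_le (J : Finset ι) [Nonempty ι] :
    ∫ h, (∑ i ∈ J, h i ^ 2) / ∑ i, h i ^ 2 ∂(Measure.pi fun _ : ι ↦ gaussianReal 0 1) ≤
      J.card / Fintype.card ι := by
  classical
  set μ := Measure.pi fun _ : ι ↦ gaussianReal 0 1 with hμ
  have hint : ∀ j : ι, Integrable (fun h : ι → ℝ ↦ h j ^ 2 / ∑ i, h i ^ 2) μ := by
    intro j
    simpa using integrable_sum_sq_div_sum_sq {j}
  have hsum : ∀ K : Finset ι, ∫ h, (∑ i ∈ K, h i ^ 2) / ∑ i, h i ^ 2 ∂μ =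
      ∑ j ∈ K, ∫ h, h j ^ 2 / ∑ i, h i ^ 2 ∂μ := by
    intro K
    simp_rw [Finset.sum_div]
    exact integral_finsetSum _ fun j _ ↦ hint j
  have hsymm : ∀ j k : ι, ∫ h, h j ^ 2 / ∑ i, h i ^ 2 ∂μ = ∫ h, h k ^ 2 / ∑ i, h i ^ 2 ∂μ := by
    intro j k
    have hm := measurePreserving_piCongrLeft (α := fun _ : ι ↦ ℝ)
      (fun _ : ι ↦ gaussianReal 0 1) (Equiv.swap j k)
    have happ : ∀ (h : ι → ℝ) (i : ι),
        MeasurableEquiv.piCongrLeft (fun _ : ι ↦ ℝ) (Equiv.swap j k) h i =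
          h (Equiv.swap j k i) := by
      intro h i
      have := MeasurableEquiv.piCongrLeft_apply_apply (β := fun _ : ι ↦ ℝ)
        (Equiv.swap j k) h (Equiv.swap j k i)
      rwa [Equiv.swap_apply_self] at this
    rw [← hm.integral_comp' (fun h ↦ h j ^ 2 / ∑ i, h i ^ 2)]
    simp_rw [happ, fun h : ι → ℝ ↦ Equiv.sum_comp (Equiv.swap j k) fun i ↦ h i ^ 2,
      Equiv.swap_apply_left]
    rfl
  obtain ⟨j₀⟩ := ‹Nonempty ι›
  have hc : (0 : ℝ) < Fintype.card ι := by exact_mod_cast Fintype.card_pos_iff.2 ⟨j₀⟩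
  have htot : ∫ h, (∑ i, h i ^ 2) / ∑ i, h i ^ 2 ∂μ ≤ 1 := by
    calc _ ≤ ∫ _ : ι → ℝ, (1 : ℝ) ∂μ :=
          integral_mono (integrable_sum_sq_div_sum_sq _) (integrable_const _)
            fun h ↦ (sum_sq_div_sum_sq_mem_Icc Finset.univ h).2
      _ = 1 := by simp
  rw [hsum, Finset.sum_congr rfl fun j _ ↦ hsymm j j₀, Finset.sum_const, nsmul_eq_mul] at htot ⊢
  rw [Finset.card_univ] at htot
  rw [le_div_iff₀ hc]
  nlinarith [mul_le_mul_of_nonneg_left htot (Nat.cast_nonneg (α := ℝ) J.card)]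

lemma ae_sum_sq_pos {J : Finset ι} (hJ : J.Nonempty) :
    ∀ᵐ h ∂(Measure.pi fun _ : ι ↦ gaussianReal 0 1), 0 < ∑ i ∈ J, h i ^ 2 := by
  obtain ⟨j, hj⟩ := hJ
  have := nullSingletonClass_gaussianReal (μ := 0) (v := 1) one_ne_zero
  have h0 : ∀ᵐ x ∂gaussianReal 0 1, x ≠ 0 := by simp [ae_iff]
  filter_upwards [(measurePreserving_eval (fun _ : ι ↦ gaussianReal 0 1) j).quasiMeasurePreserving.ae
    h0] with h hh
  have : 0 < h j ^ 2 := by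
    have : h j ≠ 0 := hh
    positivity
  exact this.trans_le (Finset.single_le_sum (f := fun i ↦ h i ^ 2) (fun i _ ↦ sq_nonneg _) hj)

/-- The ratio of the norm of `h` to the norm of its restriction to the coordinates in `J`. -/
noncomputable def normRatio (J : Finset ι) (h : ι → ℝ) : ℝ :=
  √(∑ i, h i ^ 2) / √(∑ i ∈ J, h i ^ 2)

lemma measurable_normRatio (J : Finset ι) : Measurable (normRatio J) := by
  unfold normRatio
  fun_prop

lemma normRatio_sq (J : Finset ι) (h : ι → ℝ) :
    normRatio J h ^ 2 = (∑ i, h i ^ 2) / ∑ i ∈ J, h i ^ 2 := by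
  rw [normRatio, div_pow, Real.sq_sqrt (Finset.sum_nonneg fun i _ ↦ sq_nonneg _),
    Real.sq_sqrt (Finset.sum_nonneg fun i _ ↦ sq_nonneg _)]

lemma normRatio_sq_le [DecidableEq ι] (J : Finset ι) (h : ι → ℝ) :
    normRatio J h ^ 2 ≤ 1 + ∑ j ∈ Jᶜ, h j ^ 2 / ∑ i ∈ J, h i ^ 2 := by
  rw [normRatio_sq, ← Finset.sum_add_sum_compl J, add_div, Finset.sum_div Jᶜ]
  gcongr
  exact div_self_le_one _

lemma memLp_normRatio {J : Finset ι} (hJ : 2 < J.card) :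
    MemLp (normRatio J) 2 (Measure.pi fun _ : ι ↦ gaussianReal 0 1) := by
  classical
  rw [memLp_two_iff_integrable_sq (measurable_normRatio J).aestronglyMeasurable]
  refine Integrable.mono' ((integrable_const (1 : ℝ)).add (integrable_finsetSum Jᶜ fun j hj ↦
    integrable_sq_div_sum_sq (Finset.mem_compl.1 hj) hJ))
    ((measurable_normRatio J).pow_const 2).aestronglyMeasurable (ae_of_all _ fun h ↦ ?_)
  rw [Real.norm_eq_abs, abs_of_nonneg (sq_nonneg _)]
  simpa using normRatio_sq_le J h

lemma integral_normRatio_sq_le {J : Finset ι} (hJ : 2 < J.card) :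
    ∫ h, normRatio J h ^ 2 ∂(Measure.pi fun _ : ι ↦ gaussianReal 0 1) ≤
      ((Fintype.card ι : ℝ) - 2) / (J.card - 2) := by
  classical
  have hJ' : (2 : ℝ) < J.card := by exact_mod_cast hJ
  have hi : ∀ j ∈ Jᶜ, Integrable (fun h : ι → ℝ ↦ h j ^ 2 / ∑ i ∈ J, h i ^ 2)
      (Measure.pi fun _ : ι ↦ gaussianReal 0 1) := fun j hj ↦
    integrable_sq_div_sum_sq (Finset.mem_compl.1 hj) hJ
  calc
    _ ≤ ∫ h, (1 + ∑ j ∈ Jᶜ, h j ^ 2 / ∑ i ∈ J, h i ^ 2)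
          ∂(Measure.pi fun _ : ι ↦ gaussianReal 0 1) :=
      integral_mono (memLp_normRatio hJ).integrable_sq
        ((integrable_const (1 : ℝ)).add (integrable_finsetSum _ hi)) (normRatio_sq_le J)
    _ = 1 + ∑ j ∈ Jᶜ, ∫ h, h j ^ 2 / ∑ i ∈ J, h i ^ 2
          ∂(Measure.pi fun _ : ι ↦ gaussianReal 0 1) := by
      rw [integral_add (integrable_const _) (integrable_finsetSum _ hi),
        integral_finsetSum _ hi]
      simp
    _ ≤ 1 + ∑ j ∈ Jᶜ, 1 / ((J.card : ℝ) - 2) := by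
      gcongr with j hj
      exact integral_sq_div_sum_sq_le (Finset.mem_compl.1 hj) hJ
    _ = _ := by
      have : (J.card : ℝ) - 2 ≠ 0 := by linarith
      rw [Finset.sum_const, nsmul_eq_mul, Finset.card_compl, Nat.cast_sub (Finset.card_le_univ J)]
      field_simp
      ring

lemma sqrt_card_div_card_le_integral_normRatio {J : Finset ι} (hJ : 2 < J.card) :
    √((Fintype.card ι : ℝ) / J.card) ≤
      ∫ h, normRatio J h ∂(Measure.pi fun _ : ι ↦ gaussianReal 0 1) := by
  set r := √((Fintype.card ι : ℝ) / J.card) with hr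
  have hne : J.Nonempty := Finset.card_pos.1 (by omega)
  have : Nonempty ι := ⟨hne.choose⟩
  have hJ0 : (0 : ℝ) < J.card := by exact_mod_cast (by omega : 0 < J.card)
  have hL0 : (0 : ℝ) < Fintype.card ι := by exact_mod_cast Fintype.card_pos
  have hr0 : 0 < r := Real.sqrt_pos.2 (by positivity)
  have hr2 : r ^ 2 = Fintype.card ι / J.card := Real.sq_sqrt (by positivity)
  have hle : ∀ᵐ h ∂(Measure.pi fun _ : ι ↦ gaussianReal 0 1),
      3 / 2 * r - r ^ 3 / 2 * ((∑ i ∈ J, h i ^ 2) / ∑ i, h i ^ 2) ≤ normRatio J h := by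
    filter_upwards [ae_sum_sq_pos hne] with h hA
    have hS : 0 < ∑ i, h i ^ 2 := hA.trans_le (Finset.sum_le_sum_of_subset_of_nonneg
      (Finset.subset_univ J) fun i _ _ ↦ sq_nonneg _)
    have hC : 0 < normRatio J h := div_pos (Real.sqrt_pos.2 hS) (Real.sqrt_pos.2 hA)
    rw [← inv_div (∑ i, h i ^ 2), ← normRatio_sq]
    set c := normRatio J h
    have key : c - (3 / 2 * r - r ^ 3 / 2 * (c ^ 2)⁻¹) =
        (c - r) ^ 2 * (2 * c + r) / (2 * c ^ 2) := by
      field_simp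
      ring
    have : 0 ≤ (c - r) ^ 2 * (2 * c + r) / (2 * c ^ 2) := by positivity
    linarith
  have hint := (integrable_sum_sq_div_sum_sq J).const_mul (r ^ 3 / 2)
  calc
    r = 3 / 2 * r - r ^ 3 / 2 * (J.card / Fintype.card ι) := by
      have : r ^ 3 = r * (Fintype.card ι / J.card) := by rw [← hr2]; ring
      rw [this]
      field_simp
      ring
    _ ≤ 3 / 2 * r - r ^ 3 / 2 * ∫ h, (∑ i ∈ J, h i ^ 2) / ∑ i, h i ^ 2
          ∂(Measure.pi fun _ : ι ↦ gaussianReal 0 1) := by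
      gcongr
      exact integral_sum_sq_div_sum_sq_le J
    _ = ∫ h, (3 / 2 * r - r ^ 3 / 2 * ((∑ i ∈ J, h i ^ 2) / ∑ i, h i ^ 2))
          ∂(Measure.pi fun _ : ι ↦ gaussianReal 0 1) := by
      rw [integral_sub (integrable_const _) hint, integral_const_mul (r ^ 3 / 2)]
      simp
    _ ≤ _ := integral_mono_ae ((integrable_const _).sub hint)
      ((memLp_normRatio hJ).integrable one_le_two) hle

end StandardGaussian

/-- One-sided Chebyshev bound from a bound `M` on the second moment and a lower bound `√q` on the
mean. -/
lemma one_sub_le_measure_le_sqrt_add {Ω : Type*} [MeasurableSpace Ω] {μ : Measure Ω}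
    [IsProbabilityMeasure μ] {X : Ω → ℝ} (hX : MemLp X 2 μ) (hXm : Measurable X) {M q k : ℝ}
    (hM : ∫ ω, X ω ^ 2 ∂μ ≤ M) (hq : 0 ≤ q) (hmean : √q ≤ ∫ ω, X ω ∂μ) (hqM : q < M)
    (hk : 0 < k) :
    1 - ENNReal.ofReal (1 / k ^ 2) ≤ μ {ω | X ω ≤ √M + k * √(M - q)} := by
  have hs : 0 < √(M - q) := Real.sqrt_pos.2 (by linarith)
  have hvar : Var[X; μ] = ∫ ω, X ω ^ 2 ∂μ - (∫ ω, X ω ∂μ) ^ 2 := variance_eq_sub hX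
  have hm2 : q ≤ (∫ ω, X ω ∂μ) ^ 2 := by
    rw [← Real.sq_sqrt hq]
    gcongr
  have hmM : ∫ ω, X ω ∂μ ≤ √M := Real.le_sqrt_of_sq_le (by linarith [variance_nonneg X μ])
  have hmeas : MeasurableSet {ω | X ω ≤ √M + k * √(M - q)} := measurableSet_le hXm (by fun_prop)
  have hcompl : μ {ω | X ω ≤ √M + k * √(M - q)}ᶜ ≤ ENNReal.ofReal (1 / k ^ 2) :=
    calc
      _ ≤ μ {ω | k * √(M - q) ≤ |X ω - ∫ ω, X ω ∂μ|} := by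
        refine measure_mono fun ω hω ↦ ?_
        simp only [Set.mem_compl_iff, Set.mem_ofPred_eq, not_le] at hω ⊢
        exact le_trans (by linarith) (le_abs_self _)
      _ ≤ ENNReal.ofReal (Var[X; μ] / (k * √(M - q)) ^ 2) :=
        meas_ge_le_variance_div_sq hX (by positivity)
      _ ≤ ENNReal.ofReal (1 / k ^ 2) := by
        apply ENNReal.ofReal_le_ofReal
        rw [mul_pow, Real.sq_sqrt (by linarith), div_le_div_iff₀
          (mul_pos (by positivity) (by linarith)) (by positivity)]
        nlinarith [sq_nonneg k, mul_le_mul_of_nonneg_right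
          (show Var[X; μ] ≤ M - q by linarith) (sq_nonneg k)]
  rw [prob_compl_eq_one_sub hmeas] at hcompl
  rw [tsub_le_iff_left] at hcompl ⊢
  rwa [add_comm] at hcompl

/-- Proposition 3's constant bound: for a standard Gaussian vector `h`
in `ℝ^L`, `2 < T ≤ L`, `C = sqrt(∑_{i≤L} h_i²)/sqrt(∑_{i≤T} h_i²)`, and any `k > 0`,
with probability at least `1 - 1/k²`,
`C ≤ sqrt((L-2)/(T-2)) + k·sqrt((L-2)/(T-2) − L/T)`. -/
theorem stmt17 (L T : ℕ) (hT : 2 < T) (hTL : T ≤ L) (k : ℝ) (hk : 0 < k) :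
    1 - ENNReal.ofReal (1 / k ^ 2) ≤
      (Measure.pi fun _ : Fin L => gaussianReal 0 1)
        {h : Fin L → ℝ |
          Real.sqrt (∑ i, h i ^ 2) /
              Real.sqrt (∑ i ∈ Finset.univ.filter fun i : Fin L => (i : ℕ) < T, h i ^ 2)
            ≤ Real.sqrt (((L : ℝ) - 2) / ((T : ℝ) - 2)) +
                k * Real.sqrt (((L : ℝ) - 2) / ((T : ℝ) - 2) - (L : ℝ) / T)} := by
  have hT' : (2 : ℝ) < T := by exact_mod_cast hT
  have hcard : (Finset.univ.filter fun i : Fin L ↦ (i : ℕ) < T).card = T := by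
    rw [Fin.card_filter_val_lt, min_eq_right hTL]
  rcases hTL.eq_or_lt with rfl | hlt
  · have hself : ∀ x : ℝ, x / x ≤ 1 := div_self_le_one
    have : (T : ℝ) - 2 ≠ 0 := by linarith
    have : (T : ℝ) ≠ 0 := by linarith
    simp [*]
  · have hlt' : (T : ℝ) < L := by exact_mod_cast hlt
    have hJ : 2 < (Finset.univ.filter fun i : Fin L ↦ (i : ℕ) < T).card := by rwa [hcard]
    have hM := integral_normRatio_sq_le hJ
    have hmean := sqrt_card_div_card_le_integral_normRatio hJ
    rw [hcard, Fintype.card_fin] at hM hmean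
    refine one_sub_le_measure_le_sqrt_add (memLp_normRatio hJ) (measurable_normRatio _) hM
      (by positivity) hmean ?_ hk
    rw [div_lt_div_iff₀ (by linarith) (by linarith)]
    nlinarith
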